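/- If there is an automorphism φ of the Mycielskian μ(G) that maps the root w to a shadow vertex, then G is a star graph K_{1,m} for some m ≥ 0. Moreover, if G has at least 3 vertices, then φ(w) is the shadow vertex of the unique vertex of maximum degree of G. -/

import Mathlib

open SimpleGraph

/-- The generalized Mycielskian `μ_t(G)`: levels `0,…,t` of copies of `V(G)`
plus a root `none`. Level-0 vertices are the original vertices. -/
def genMyc {V : Type*} (G : SimpleGraph V) (t : ℕ) :
    SimpleGraph (Option (Fin (t + 1) × V)) :=
  SimpleGraph.fromRel fun a b =>
    match a, b with
    | some (s, i), some (s', j) =>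
        ((s : ℕ) = 0 ∧ (s' : ℕ) = 0 ∧ G.Adj i j) ∨
        ((s' : ℕ) = (s : ℕ) + 1 ∧ G.Adj i j)
    | some (s, _), none => (s : ℕ) = t
    | _, _ => False

/-- The (traditional) Mycielskian `μ(G)`. -/
def myc {V : Type*} (G : SimpleGraph V) : SimpleGraph (Option (Fin 2 × V)) :=
  genMyc G 1

/-- The star `K_{1,m}` with center `0` and `m` leaves. -/
def starG (m : ℕ) : SimpleGraph (Fin (m + 1)) :=
  SimpleGraph.fromRel fun a _ => a = 0

/-- A `d`-coloring is distinguishing if only the trivial automorphism preserves it. -/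
def IsDistinguishing {V : Type*} (H : SimpleGraph V) (d : ℕ) (c : V → Fin d) : Prop :=
  ∀ φ : H ≃g H, (∀ v, c (φ v) = c v) → ∀ v, φ v = v

/-- The distinguishing number of a graph. -/
noncomputable def distNum {V : Type*} (H : SimpleGraph V) : ℕ :=
  sInf {d | ∃ c : V → Fin d, IsDistinguishing H d c}

theorem myc_adj_root {V : Type*} (G : SimpleGraph V) (i : V) :
    (myc G).Adj none (some (1, i)) := by
  simp [myc, genMyc]

theorem myc_adj_shadow {V : Type*} (G : SimpleGraph V) (v : V) (x : Option (Fin 2 × V))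
    (h : (myc G).Adj (some (1, v)) x) : x = none ∨ ∃ j, x = some (0, j) ∧ G.Adj v j := by
  rcases x with _ | ⟨s, j⟩
  · exact Or.inl rfl
  · right
    fin_cases s
    · refine ⟨j, rfl, ?_⟩
      simpa [myc, genMyc, G.adj_comm] using h
    · simp [myc, genMyc] at h

theorem myc_adj_orig {V : Type*} (G : SimpleGraph V) (y z : V) (h : G.Adj y z) :
    (myc G).Adj (some (0, y)) (some (0, z)) := by
  simp [myc, genMyc, h, h.ne]

theorem myc_shadow_indep {V : Type*} (G : SimpleGraph V) (y z : V) :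
    ¬ (myc G).Adj (some (1, y)) (some (1, z)) := by
  simp [myc, genMyc]

theorem star_structure {V : Type*} [Fintype V] (G : SimpleGraph V)
    (φ : myc G ≃g myc G) (v : V) (h : φ none = some (1, v)) (a b : V) :
    G.Adj a b ↔ a ≠ b ∧ (a = v ∨ b = v) := by
  classical
  have key : ∀ i : V, φ (some (1, i)) = none ∨ ∃ j, φ (some (1, i)) = some (0, j) ∧ G.Adj v j := by
    intro i
    apply myc_adj_shadow
    rw [← h]
    exact φ.map_rel_iff.2 (myc_adj_root G i)
  have hex : ∀ i : V, ∃ j, (φ (some (1, i)) = none ∧ j = v) ∨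
      (φ (some (1, i)) = some (0, j) ∧ G.Adj v j) := by
    intro i
    rcases key i with h1 | ⟨j, h1, h2⟩
    · exact ⟨v, Or.inl ⟨h1, rfl⟩⟩
    · exact ⟨j, Or.inr ⟨h1, h2⟩⟩
  choose g hg using hex
  have ginj : Function.Injective g := by
    intro i k hik
    have : φ (some (1, i)) = φ (some (1, k)) := by
      rcases hg i with ⟨h1, h2⟩ | ⟨h1, h2⟩ <;> rcases hg k with ⟨h3, h4⟩ | ⟨h3, h4⟩
      · rw [h1, h3]
      · rw [← hik, h2] at h4; exact absurd h4 (G.irrefl)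
      · rw [hik, h4] at h2; exact absurd h2 (G.irrefl)
      · rw [h1, h3, hik]
    simpa using φ.injective this
  have gsurj := Finite.surjective_of_injective ginj
  have hN : ∀ j, j ≠ v → G.Adj v j ∧ ∃ i, φ (some (1, i)) = some (0, j) := by
    intro j hj
    obtain ⟨i, rfl⟩ := gsurj j
    rcases hg i with ⟨_, h2⟩ | ⟨h1, h2⟩
    · exact absurd h2 hj
    · exact ⟨h2, i, h1⟩
  constructor
  · intro hab
    refine ⟨hab.ne, ?_⟩
    by_contra! hc
    obtain ⟨i, hi⟩ := (hN a hc.1).2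
    obtain ⟨k, hk⟩ := (hN b hc.2).2
    have := myc_adj_orig G a b hab
    rw [← hi, ← hk] at this
    exact myc_shadow_indep G i k (φ.map_rel_iff.1 this)
  · rintro ⟨hne, rfl | rfl⟩
    · exact (hN b hne.symm).1
    · exact (hN a hne).1.symm

theorem stmt_2 {V : Type*} [Fintype V] (G : SimpleGraph V) [DecidableRel G.Adj]
    (φ : myc G ≃g myc G) (v : V) (h : φ none = some (1, v)) :
    (∃ m : ℕ, Nonempty (G ≃g starG m)) ∧
    (3 ≤ Fintype.card V → ∀ y : V, y ≠ v → G.degree y < G.degree v) := by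
  classical
  have hs := star_structure G φ v h
  constructor
  · have hpos : 0 < Fintype.card V := Fintype.card_pos_iff.2 ⟨v⟩
    obtain ⟨m, hm⟩ : ∃ m, Fintype.card V = m + 1 := ⟨Fintype.card V - 1, by omega⟩
    let e : V ≃ Fin (m + 1) := Fintype.equivFinOfCardEq hm
    let e' : V ≃ Fin (m + 1) := e.trans (Equiv.swap (e v) 0)
    have he : e' v = 0 := by simp [e']
    refine ⟨m, ⟨⟨e', ?_⟩⟩⟩
    intro a b
    rw [hs, starG, SimpleGraph.fromRel_adj, ← he]
    simp only [ne_eq, e'.injective.eq_iff]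
  · intro hc y hy
    have h1 : G.neighborFinset y = {v} := by
      ext z
      simp only [SimpleGraph.mem_neighborFinset, hs, Finset.mem_singleton]
      grind
    have h2 : G.neighborFinset v = Finset.univ.erase v := by
      ext z
      simp only [SimpleGraph.mem_neighborFinset, hs, Finset.mem_erase, Finset.mem_univ]
      grind
    rw [← SimpleGraph.card_neighborFinset_eq_degree, ← SimpleGraph.card_neighborFinset_eq_degree,
      h1, h2, Finset.card_erase_of_mem (Finset.mem_univ v), Finset.card_singleton,
      Finset.card_univ]
    omega
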